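/- Fix an integer k ≥ 2. Call a finite set A of positive integers k-chain-free if there do not exist distinct elements x₁, ..., x_k ∈ A with x₁ ∣ x₂ ∣ ⋯ ∣ x_k. Let f_k(n) be the maximum cardinality of a k-chain-free subset of {1, ..., n}. Then there exists a real constant γ_k such that for every ε > 0 there is a constant K_ε with |f_k(n) − γ_k·n| ≤ K_ε · n · exp(−(1−ε)·√(log n · log log n)) for all n ≥ 3. -/

import Mathlib

open Finset
open scoped Classical

/-- A finite set of positive integers is `k`-chain-free if it contains no `k` distinct
elements `x₁ ∣ x₂ ∣ ⋯ ∣ x_k`. -/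
def KChainFree (k : ℕ) (A : Finset ℕ) : Prop :=
  ¬∃ x : Fin k → ℕ, Function.Injective x ∧ (∀ i, x i ∈ A) ∧
      ∀ (i : ℕ) (h : i + 1 < k), x ⟨i, Nat.lt_of_succ_lt h⟩ ∣ x ⟨i + 1, h⟩

/-- `f_k(n)`: the maximum cardinality of a `k`-chain-free subset of `{1, …, n}`. -/
noncomputable def fChain (k n : ℕ) : ℕ :=
  ((Finset.Icc 1 n).powerset.filter (KChainFree k)).sup Finset.card

/-- The largest size of a `k`-chain-free subset of `S`. -/
noncomputable def maxChainFree (k : ℕ) (S : Finset ℕ) : ℕ :=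
  (S.powerset.filter (KChainFree k)).sup Finset.card

lemma KChainFree.mono {k : ℕ} {A B : Finset ℕ} (h : KChainFree k B) (hAB : A ⊆ B) :
    KChainFree k A := fun ⟨x, hx, hxA, hdvd⟩ => h ⟨x, hx, fun i => hAB (hxA i), hdvd⟩

lemma card_le_maxChainFree {k : ℕ} {A S : Finset ℕ} (hA : A ⊆ S) (h : KChainFree k A) :
    A.card ≤ maxChainFree k S :=
  Finset.le_sup (f := Finset.card) (by simp [hA, h])

lemma maxChainFree_le {k c : ℕ} {S : Finset ℕ}
    (h : ∀ A ⊆ S, KChainFree k A → A.card ≤ c) : maxChainFree k S ≤ c := by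
  refine Finset.sup_le fun A hA => ?_
  simp only [mem_filter, mem_powerset] at hA
  exact h A hA.1 hA.2

lemma kChainFree_empty {k : ℕ} (hk : 0 < k) : KChainFree k ∅ :=
  fun ⟨_, _, hxA, _⟩ => by simpa using hxA ⟨0, hk⟩

lemma exists_card_eq_maxChainFree {k : ℕ} (hk : 0 < k) (S : Finset ℕ) :
    ∃ A ⊆ S, KChainFree k A ∧ A.card = maxChainFree k S := by
  obtain ⟨A, hA, h⟩ := Finset.exists_mem_eq_sup (S.powerset.filter (KChainFree k))
    ⟨∅, by simp [kChainFree_empty hk]⟩ Finset.card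
  simp only [mem_filter, mem_powerset] at hA
  exact ⟨A, hA.1, hA.2, h.symm⟩

lemma maxChainFree_mono {k : ℕ} {S T : Finset ℕ} (h : S ⊆ T) :
    maxChainFree k S ≤ maxChainFree k T :=
  maxChainFree_le fun _ hA hf => card_le_maxChainFree (hA.trans h) hf

lemma maxChainFree_le_erase_add_one {k : ℕ} (S : Finset ℕ) (s : ℕ) :
    maxChainFree k S ≤ maxChainFree k (S.erase s) + 1 := by
  refine maxChainFree_le fun A hA hf => ?_
  have h1 := card_le_maxChainFree (Finset.erase_subset_erase s hA) (hf.mono (A.erase_subset s))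
  have h2 := Finset.pred_card_le_card_erase (s := A) (a := s)
  omega

/-- Chains do not cross between sets without mutual divisibilities. -/
lemma KChainFree.union {k : ℕ} {C R : Finset ℕ} (hC : KChainFree k C) (hR : KChainFree k R)
    (hCR : ∀ c ∈ C, ∀ r ∈ R, ¬ c ∣ r ∧ ¬ r ∣ c) : KChainFree k (C ∪ R) := by
  rintro ⟨x, hx, hxA, hdvd⟩
  by_cases h0 : ∃ h : 0 < k, x ⟨0, h⟩ ∈ R
  · obtain ⟨h0, hx0⟩ := h0
    refine hR ⟨x, hx, ?_, hdvd⟩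
    rintro ⟨i, hi⟩
    induction i with
    | zero => exact hx0
    | succ i ih =>
      rcases Finset.mem_union.1 (hxA ⟨i + 1, hi⟩) with h | h
      · exact absurd (hdvd i hi) (hCR _ h _ (ih (by omega))).2
      · exact h
  · refine hC ⟨x, hx, ?_, hdvd⟩
    rintro ⟨i, hi⟩
    induction i with
    | zero =>
      rcases Finset.mem_union.1 (hxA ⟨0, hi⟩) with h | h
      · exact h
      · exact absurd ⟨hi, h⟩ h0
    | succ i ih =>
      rcases Finset.mem_union.1 (hxA ⟨i + 1, hi⟩) with h | h
      · exact h
      · exact absurd (hdvd i hi) (hCR _ (ih (by omega)) _ h).1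

lemma maxChainFree_union {k : ℕ} (hk : 0 < k) {C R : Finset ℕ}
    (hCR : ∀ c ∈ C, ∀ r ∈ R, ¬ c ∣ r ∧ ¬ r ∣ c) :
    maxChainFree k (C ∪ R) = maxChainFree k C + maxChainFree k R := by
  apply le_antisymm
  · refine maxChainFree_le fun A hA hf => ?_
    have h1 := card_le_maxChainFree (Finset.inter_subset_right (s₁ := A) (s₂ := C))
      (hf.mono Finset.inter_subset_left)
    have h2 := card_le_maxChainFree (Finset.inter_subset_right (s₁ := A) (s₂ := R))
      (hf.mono Finset.inter_subset_left)
    have h3 : A = A ∩ C ∪ A ∩ R := by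
      rw [← Finset.inter_union_distrib_left, Finset.inter_eq_left.2 hA]
    have h4 := Finset.card_union_le (A ∩ C) (A ∩ R)
    rw [← h3] at h4
    omega
  · obtain ⟨A, hA, hAf, hAc⟩ := exists_card_eq_maxChainFree hk C
    obtain ⟨B, hB, hBf, hBc⟩ := exists_card_eq_maxChainFree hk R
    have hdisj : Disjoint A B := Finset.disjoint_left.2 fun a ha hb =>
      (hCR a (hA ha) a (hB hb)).1 dvd_rfl
    rw [← hAc, ← hBc, ← Finset.card_union_of_disjoint hdisj]
    exact card_le_maxChainFree (Finset.union_subset_union hA hB)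
      (hAf.union hBf fun c hc r hr => hCR c (hA hc) r (hB hr))

lemma kChainFree_image_mul {k u : ℕ} (hu : 0 < u) {A : Finset ℕ} :
    KChainFree k (A.image (u * ·)) ↔ KChainFree k A := by
  refine not_congr ⟨?_, ?_⟩
  · rintro ⟨x, hx, hxA, hdvd⟩
    simp only [mem_image] at hxA
    choose y hyA hy using hxA
    refine ⟨y, fun i j hij => hx (by rw [← hy i, ← hy j, hij]), hyA, fun i h => ?_⟩
    have := hdvd i h
    rw [← hy, ← hy] at this
    exact Nat.dvd_of_mul_dvd_mul_left hu this
  · rintro ⟨x, hx, hxA, hdvd⟩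
    exact ⟨fun i => u * x i, fun i j hij => hx (Nat.eq_of_mul_eq_mul_left hu hij),
      fun i => Finset.mem_image_of_mem _ (hxA i), fun i h => Nat.mul_dvd_mul_left u (hdvd i h)⟩

lemma maxChainFree_image_mul {k u : ℕ} (hu : 0 < u) (S : Finset ℕ) :
    maxChainFree k (S.image (u * ·)) = maxChainFree k S := by
  have hinj : Function.Injective (u * ·) := fun a b h => Nat.eq_of_mul_eq_mul_left hu h
  apply le_antisymm
  · refine maxChainFree_le fun A hA hf => ?_
    obtain ⟨B, hB, rfl⟩ := Finset.subset_image_iff.1 hA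
    rw [Finset.card_image_of_injective _ hinj]
    exact card_le_maxChainFree hB ((kChainFree_image_mul hu).1 hf)
  · refine maxChainFree_le fun A hA hf => ?_
    rw [← Finset.card_image_of_injective A hinj]
    exact card_le_maxChainFree (Finset.image_subset_image hA) ((kChainFree_image_mul hu).2 hf)

/-- The change of the maximal chain-free size when `s` is added to `{s + 1, …, n}`. -/
noncomputable def jump (k s n : ℕ) : ℝ :=
  (maxChainFree k (Icc s n) : ℝ) - maxChainFree k (Icc (s + 1) n)

lemma jump_nonneg (k s n : ℕ) : 0 ≤ jump k s n := by
  have := maxChainFree_mono (k := k) (Finset.Icc_subset_Icc_left (b := n) (Nat.le_succ s))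
  rw [jump, sub_nonneg]
  exact_mod_cast this

lemma jump_le_one (k s n : ℕ) : jump k s n ≤ 1 := by
  have h1 := maxChainFree_le_erase_add_one (k := k) (Icc s n) s
  have h2 := maxChainFree_mono (k := k) (S := (Icc s n).erase s) (T := Icc (s + 1) n)
    (fun a ha => by simp only [mem_erase, mem_Icc] at ha ⊢; omega)
  rw [jump, sub_le_iff_le_add']
  exact_mod_cast (by omega : maxChainFree k (Icc s n) ≤ maxChainFree k (Icc (s + 1) n) + 1)

lemma abs_jump_le_one (k s n : ℕ) : |jump k s n| ≤ 1 := by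
  rw [abs_of_nonneg (jump_nonneg k s n)]
  exact jump_le_one k s n

lemma fChain_eq_sum_jump {k : ℕ} (n : ℕ) :
    (fChain k n : ℝ) = ∑ s ∈ Icc 1 n, jump k s n := by
  have h : ∀ m, ∑ s ∈ Ico 1 (m + 1), jump k s n =
      maxChainFree k (Icc 1 n) - maxChainFree k (Icc (m + 1) n) := by
    intro m
    induction m with
    | zero => simp
    | succ m ih =>
      rw [Finset.sum_Ico_succ_top (by omega), ih, jump]
      ring
  have h0 : maxChainFree k (Icc (n + 1) n) = 0 := by
    refine Nat.le_zero.1 (maxChainFree_le fun A hA _ => ?_)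
    simpa using hA
  have := h n
  rw [h0] at this
  rw [← Finset.Ico_add_one_right_eq_Icc, this]
  simp [fChain, maxChainFree]

/-- Only the multiples `u * m` with `m` smooth interact with `s = u * d`. -/
lemma jump_eq_smooth {k : ℕ} (hk : 0 < k) {d u n t : ℕ} (hd : d ∈ Nat.smoothNumbers (t + 1))
    (hu0 : 0 < u) (hu : ∀ p, p.Prime → p ∣ u → t < p) (ht : n / (u * d) = t) :
    jump k (u * d) n =
      (maxChainFree k ((Icc d (n / u)).filter (· ∈ Nat.smoothNumbers (t + 1))) : ℝ) -
      maxChainFree k ((Icc (d + 1) (n / u)).filter (· ∈ Nat.smoothNumbers (t + 1))) := by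
  have hd0 : 0 < d := Nat.pos_of_ne_zero (Nat.ne_zero_of_mem_smoothNumbers hd)
  set S := (Icc d (n / u)).filter (· ∈ Nat.smoothNumbers (t + 1)) with hS
  set S' := (Icc (d + 1) (n / u)).filter (· ∈ Nat.smoothNumbers (t + 1)) with hS'
  have hSS : S' ⊆ S := by
    intro a ha
    simp only [hS, hS', mem_filter, mem_Icc] at ha ⊢
    exact ⟨⟨by omega, ha.1.2⟩, ha.2⟩
  set R := Icc (u * d) n \ S.image (u * ·) with hR
  have hsub : S.image (u * ·) ⊆ Icc (u * d) n := by
    intro a ha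
    simp only [hS, mem_image, mem_filter, mem_Icc] at ha ⊢
    obtain ⟨m, ⟨⟨h1, h2⟩, -⟩, rfl⟩ := ha
    exact ⟨Nat.mul_le_mul_left u h1, (Nat.mul_le_mul_left u h2).trans (Nat.mul_div_le n u)⟩
  have hratio : ∀ a b, u * d ≤ a → a ∣ b → b ≤ n → 0 < b → ∃ r ∈ Nat.smoothNumbers (t + 1),
      b = a * r ∧ r ≤ t := by
    rintro a b ha ⟨r, rfl⟩ hb hb0
    have hr0 : r ≠ 0 := by rintro rfl; simp at hb0
    have hrt : r ≤ t := by
      rw [← ht, Nat.le_div_iff_mul_le (Nat.mul_pos hu0 hd0)]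
      calc r * (u * d) ≤ r * a := Nat.mul_le_mul_left r ha
        _ ≤ n := by rw [mul_comm]; exact hb
    exact ⟨r, Nat.mem_smoothNumbers_of_lt (Nat.pos_of_ne_zero hr0) (by omega), rfl, hrt⟩
  have hcross : ∀ c ∈ S.image (u * ·), ∀ r ∈ R, ¬ c ∣ r ∧ ¬ r ∣ c := by
    intro c hc r hr
    have hcI := hsub hc
    simp only [hR, mem_sdiff] at hr
    obtain ⟨hrI, hrS⟩ := hr
    rw [mem_Icc] at hcI hrI
    have hud := Nat.mul_pos hu0 hd0
    obtain ⟨m, hm, rfl⟩ := mem_image.1 hc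
    simp only [hS, mem_filter, mem_Icc] at hm
    constructor
    · intro hdvd
      obtain ⟨q, hq, hqe, -⟩ := hratio _ _ hcI.1 hdvd hrI.2 (by omega)
      refine hrS (mem_image.2 ⟨m * q, ?_, by rw [hqe]; ring⟩)
      simp only [hS, mem_filter, mem_Icc]
      refine ⟨⟨hm.1.1.trans (Nat.le_mul_of_pos_right _ (Nat.pos_of_ne_zero
        (Nat.ne_zero_of_mem_smoothNumbers hq))), ?_⟩, Nat.mul_mem_smoothNumbers hm.2 hq⟩
      rw [Nat.le_div_iff_mul_le hu0]
      calc m * q * u = r := by rw [hqe]; ring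
        _ ≤ n := hrI.2
    · intro hdvd
      obtain ⟨q, hq, hqe, hqt⟩ := hratio _ _ hrI.1 hdvd hcI.2 (by omega)
      have hcop : Nat.Coprime q u := by
        refine Nat.Coprime.symm (Nat.coprime_of_dvd fun p hp hpu hpq => ?_)
        have := hu p hp hpu
        have := Nat.le_of_dvd (Nat.pos_of_ne_zero (Nat.ne_zero_of_mem_smoothNumbers hq)) hpq
        omega
      have hqm : q ∣ m := hcop.dvd_of_dvd_mul_left ⟨r, by rw [mul_comm q r]; exact hqe⟩
      obtain ⟨m', rfl⟩ := hqm
      have hq0 := Nat.pos_of_ne_zero (Nat.ne_zero_of_mem_smoothNumbers hq)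
      have hre : u * m' = r := by
        apply Nat.eq_of_mul_eq_mul_right hq0
        rw [← hqe]; ring
      refine hrS (mem_image.2 ⟨m', ?_, hre⟩)
      simp only [hS, mem_filter, mem_Icc]
      refine ⟨⟨?_, ?_⟩, ?_⟩
      · exact Nat.le_of_mul_le_mul_left (hre ▸ hrI.1) hu0
      · rw [Nat.le_div_iff_mul_le hu0, mul_comm, hre]; exact hrI.2
      · exact Nat.mem_smoothNumbers_of_dvd hm.2 (Dvd.intro_left q rfl)
  have hdS : d ∉ S' := by simp [hS']
  have e1 : Icc (u * d) n = S.image (u * ·) ∪ R := by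
    rw [hR, Finset.union_sdiff_of_subset hsub]
  have e2 : Icc (u * d + 1) n = S'.image (u * ·) ∪ R := by
    ext a
    simp only [hR, mem_union, mem_sdiff, mem_Icc]
    have hmem : a ∈ S.image (u * ·) → a ≠ u * d → a ∈ S'.image (u * ·) := by
      intro ha hne
      obtain ⟨m, hm, rfl⟩ := mem_image.1 ha
      refine mem_image.2 ⟨m, ?_, rfl⟩
      simp only [hS, hS', mem_filter, mem_Icc] at hm ⊢
      have : m ≠ d := by rintro rfl; exact hne rfl
      exact ⟨⟨by omega, hm.1.2⟩, hm.2⟩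
    constructor
    · intro ha
      by_cases h : a ∈ S.image (u * ·)
      · exact Or.inl (hmem h (by omega))
      · exact Or.inr ⟨⟨by omega, ha.2⟩, h⟩
    · rintro (ha | ha)
      · obtain ⟨m, hm, rfl⟩ := mem_image.1 ha
        have h1 := mem_Icc.1 (hsub (mem_image_of_mem _ (hSS hm)))
        simp only [hS', mem_filter, mem_Icc] at hm
        have : u * (d + 1) ≤ u * m := Nat.mul_le_mul_left u hm.1.1
        refine ⟨?_, h1.2⟩
        nlinarith
      · have hne : a ≠ u * d := by
          rintro rfl
          refine ha.2 (mem_image_of_mem _ ?_)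
          simp only [hS, mem_filter, mem_Icc]
          refine ⟨⟨le_rfl, ?_⟩, hd⟩
          rw [Nat.le_div_iff_mul_le hu0, mul_comm]
          exact ha.1.2
        exact ⟨by omega, ha.1.2⟩
  rw [jump, e1, e2, maxChainFree_union hk hcross, maxChainFree_union hk
    (fun c hc r hr => hcross c (image_subset_image hSS hc) r hr),
    maxChainFree_image_mul hu0, maxChainFree_image_mul hu0]
  push_cast
  ring

lemma jump_mul {k : ℕ} (hk : 0 < k) {d u n t : ℕ} (hd : d ∈ Nat.smoothNumbers (t + 1))
    (hu0 : 0 < u) (hu : ∀ p, p.Prime → p ∣ u → t < p) (ht : n / (u * d) = t) :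
    jump k (u * d) n = jump k d (n / u) := by
  have h := jump_eq_smooth hk (u := 1) (n := n / u) hd one_pos
    (fun p hp h1 => absurd (Nat.dvd_one.1 h1) hp.one_lt.ne')
    (by rw [one_mul, Nat.div_div_eq_div_mul, ht])
  rw [one_mul, Nat.div_one] at h
  rw [h, jump_eq_smooth hk hd hu0 hu ht]

lemma exists_rough_mul_smooth (t : ℕ) {s : ℕ} (hs : s ≠ 0) :
    ∃ u d, u.Coprime (primorial t) ∧ d ∈ Nat.smoothNumbers (t + 1) ∧ u * d = s := by
  induction s using induction_on_primes with
  | zero => exact absurd rfl hs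
  | one => exact ⟨1, 1, by simp, by simp [Nat.mem_smoothNumbers], rfl⟩
  | prime_mul p m hp ih =>
    obtain ⟨u, d, hu, hd, rfl⟩ := ih (right_ne_zero_of_mul hs)
    by_cases hpt : p ≤ t
    · exact ⟨u, p * d, hu, Nat.mul_mem_smoothNumbers
        (Nat.mem_smoothNumbers_of_lt hp.pos (by omega)) hd, by ring⟩
    · refine ⟨p * u, d, Nat.Coprime.mul_left ?_ hu, hd, by ring⟩
      rw [hp.coprime_iff_not_dvd, hp.dvd_primorial_iff]
      exact hpt

lemma coprime_of_mem_smoothNumbers {t u d : ℕ} (hu : u.Coprime (primorial t))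
    (hd : d ∈ Nat.smoothNumbers (t + 1)) : d.Coprime u := by
  refine Nat.coprime_of_dvd fun p hp hpd hpu => ?_
  have hpt : p ≤ t := Nat.lt_succ_iff.1 (Nat.mem_smoothNumbers'.1 hd p hp hpd)
  exact hp.coprime_iff_not_dvd.1 (hu.coprime_dvd_left hpu) (hp.dvd_primorial_iff.2 hpt)

/-- The part of `fChain k n` coming from the `s` with `⌊n / s⌋ = t`. -/
noncomputable def jumpLayer (k n t : ℕ) : ℝ :=
  ∑ s ∈ (Icc 1 n).filter (fun s => n / s = t), jump k s n

/-- The number of multiples `u` of `e` with `⌊n / u⌋ = N`. -/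
noncomputable def layerCount (n e N : ℕ) : ℝ := ((n / N / e : ℕ) : ℝ) - ((n / (N + 1) / e : ℕ) : ℝ)

/-- The part of a layer coming from multiples `u * d` where `e ∣ u`. -/
noncomputable def layerTerm (k n t d e : ℕ) : ℝ :=
  ∑ N ∈ Ico (d * t) (d * (t + 1)), jump k d N * layerCount n e N

lemma jumpLayer_eq_sum_rough {k : ℕ} (hk : 0 < k) (n : ℕ) {t : ℕ} (ht : 0 < t) :
    jumpLayer k n t = ∑ d ∈ (Icc 1 n).filter (· ∈ Nat.smoothNumbers (t + 1)),
      ∑ u ∈ (Icc 1 n).filter (fun u => u.Coprime (primorial t)),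
        if n / u / d = t then jump k d (n / u) else 0 := by
  simp_rw [← Finset.sum_filter]
  rw [Finset.sum_sigma', jumpLayer]
  symm
  refine Finset.sum_bij (fun x _ => x.2 * x.1) ?_ ?_ ?_ ?_
  · rintro ⟨d, u⟩ h
    simp only [mem_sigma, mem_filter, mem_Icc] at h ⊢
    have h2 : n / (u * d) = t := by rw [← Nat.div_div_eq_div_mul]; exact h.2.2
    refine ⟨⟨Nat.mul_pos h.2.1.1.1 h.1.1.1, ?_⟩, h2⟩
    by_contra hlt
    rw [Nat.div_eq_of_lt (by omega)] at h2
    omega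
  · rintro ⟨d, u⟩ h ⟨d', u'⟩ h' heq
    simp only [mem_sigma, mem_filter, mem_Icc] at h h' heq
    have hd : d = d' := Nat.dvd_antisymm
      ((coprime_of_mem_smoothNumbers h'.2.1.2 h.1.2).dvd_of_dvd_mul_left
        (heq ▸ Dvd.intro_left u rfl))
      ((coprime_of_mem_smoothNumbers h.2.1.2 h'.1.2).dvd_of_dvd_mul_left
        (heq ▸ Dvd.intro_left u' rfl))
    subst hd
    rw [Nat.eq_of_mul_eq_mul_right h.1.1.1 heq]
  · intro s hs
    simp only [mem_filter, mem_Icc] at hs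
    obtain ⟨u, d, hu, hd, rfl⟩ := exists_rough_mul_smooth t (s := s) (by omega)
    have hd0 : 0 < d := Nat.pos_of_mul_pos_left hs.1.1
    have hu0 : 0 < u := Nat.pos_of_mul_pos_right hs.1.1
    refine ⟨⟨d, u⟩, ?_, rfl⟩
    simp only [mem_sigma, mem_filter, mem_Icc]
    exact ⟨⟨⟨hd0, (Nat.le_mul_of_pos_left d hu0).trans hs.1.2⟩, hd⟩,
      ⟨⟨hu0, (Nat.le_mul_of_pos_right u hd0).trans hs.1.2⟩, hu⟩,
      by rw [Nat.div_div_eq_div_mul]; exact hs.2⟩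
  · rintro ⟨d, u⟩ h
    simp only [mem_sigma, mem_filter, mem_Icc] at h
    refine (jump_mul hk h.1.2 h.2.1.1.1 (fun p hp hpu => ?_)
      (by rw [← Nat.div_div_eq_div_mul]; exact h.2.2)).symm
    by_contra hpt
    exact hp.coprime_iff_not_dvd.1 (h.2.1.2.coprime_dvd_left hpu)
      (hp.dvd_primorial_iff.2 (not_lt.1 hpt))

lemma sum_moebius_divisors_filter_dvd {P : ℕ} (hP : P ≠ 0) (u : ℕ) :
    ∑ e ∈ P.divisors.filter (· ∣ u), (ArithmeticFunction.moebius e : ℝ) =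
      if u.Coprime P then 1 else 0 := by
  have h1 : P.divisors.filter (· ∣ u) = (u.gcd P).divisors := by
    ext e
    simp only [mem_filter, Nat.mem_divisors, Nat.dvd_gcd_iff]
    have := Nat.gcd_ne_zero_right (m := u) hP
    tauto
  rw [h1, ← Int.cast_sum]
  have h2 := ArithmeticFunction.coe_mul_zeta_apply (f := ArithmeticFunction.moebius)
    (x := u.gcd P)
  rw [ArithmeticFunction.moebius_mul_coe_zeta, ArithmeticFunction.one_apply] at h2
  rw [← h2]
  by_cases h3 : u.gcd P = 1 <;> simp [Nat.coprime_iff_gcd_eq_one, h3]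

lemma sum_coprime_eq_sum_moebius {P : ℕ} (hP : P ≠ 0) (S : Finset ℕ) (h : ℕ → ℝ) :
    ∑ u ∈ S.filter (fun u => u.Coprime P), h u =
      ∑ e ∈ P.divisors, (ArithmeticFunction.moebius e : ℝ) * ∑ u ∈ S.filter (e ∣ ·), h u := by
  simp_rw [Finset.mul_sum, Finset.sum_filter]
  rw [Finset.sum_comm]
  refine Finset.sum_congr rfl fun u _ => ?_
  rw [← Finset.sum_filter, ← Finset.sum_mul, sum_moebius_divisors_filter_dvd hP]
  split_ifs <;> simp

lemma card_dvd_div_eq (n e : ℕ) {N : ℕ} (hN : 0 < N) :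
    ((((Icc 1 n).filter (e ∣ ·)).filter (fun u => n / u = N)).card : ℝ) = layerCount n e N := by
  have key : ((Icc 1 n).filter (e ∣ ·)).filter (fun u => n / u = N) =
      (Ioc 0 (n / N)).filter (e ∣ ·) \ (Ioc 0 (n / (N + 1))).filter (e ∣ ·) := by
    ext u
    simp only [mem_filter, mem_sdiff, mem_Icc, mem_Ioc]
    have h1 : 0 < u → (n / u = N ↔ u ≤ n / N ∧ ¬ u ≤ n / (N + 1)) := by
      intro hu
      rw [Nat.le_div_iff_mul_le hN, Nat.le_div_iff_mul_le (Nat.succ_pos N), mul_comm u N,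
        mul_comm u (N + 1), ← Nat.le_div_iff_mul_le hu, ← Nat.le_div_iff_mul_le hu]
      omega
    have h2 : n / N ≤ n := Nat.div_le_self n N
    constructor
    · rintro ⟨⟨⟨ha, hb⟩, hc⟩, hd⟩
      have := (h1 ha).1 hd
      exact ⟨⟨⟨ha, this.1⟩, hc⟩, fun h => this.2 h.1.2⟩
    · rintro ⟨⟨⟨ha, hb⟩, hc⟩, hd⟩
      exact ⟨⟨⟨ha, hb.trans h2⟩, hc⟩, (h1 ha).2 ⟨hb, fun h => hd ⟨⟨ha, h⟩, hc⟩⟩⟩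
  have hsub : (Ioc 0 (n / (N + 1))).filter (e ∣ ·) ⊆ (Ioc 0 (n / N)).filter (e ∣ ·) := by
    refine Finset.filter_subset_filter _ (Finset.Ioc_subset_Ioc_right ?_)
    exact Nat.div_le_div_left (Nat.le_succ N) hN
  rw [key, Finset.cast_card_sdiff hsub, Nat.Ioc_filter_dvd_card_eq_div,
    Nat.Ioc_filter_dvd_card_eq_div, layerCount]

lemma jumpLayer_eq {k : ℕ} (hk : 0 < k) (n : ℕ) {t : ℕ} (ht : 0 < t) :
    jumpLayer k n t = ∑ d ∈ (Icc 1 n).filter (· ∈ Nat.smoothNumbers (t + 1)),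
      ∑ e ∈ (primorial t).divisors,
        (ArithmeticFunction.moebius e : ℝ) * layerTerm k n t d e := by
  rw [jumpLayer_eq_sum_rough hk n ht]
  refine Finset.sum_congr rfl fun d hd => ?_
  have hd0 : 0 < d := (mem_Icc.1 (mem_filter.1 hd).1).1
  rw [sum_coprime_eq_sum_moebius (primorial_ne_zero t)]
  refine Finset.sum_congr rfl fun e _ => ?_
  congr 1
  rw [← Finset.sum_filter]
  have hmem : ∀ N, N / d = t ↔ N ∈ Ico (d * t) (d * (t + 1)) := by
    intro N
    rw [mem_Ico, mul_comm d t, mul_comm d (t + 1), ← Nat.le_div_iff_mul_le hd0,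
      ← Nat.div_lt_iff_lt_mul hd0]
    omega
  rw [← Finset.sum_fiberwise_of_maps_to (g := fun u => n / u) (t := Ico (d * t) (d * (t + 1)))
    (fun u hu => (hmem _).1 (mem_filter.1 hu).2), layerTerm]
  refine Finset.sum_congr rfl fun N hN => ?_
  have hN0 : 0 < N := lt_of_lt_of_le (Nat.mul_pos hd0 ht) (mem_Ico.1 hN).1
  rw [← card_dvd_div_eq n e hN0, mul_comm, ← nsmul_eq_mul, ← Finset.sum_const]
  refine Finset.sum_congr ?_ ?_
  · ext u
    simp only [mem_filter]
    constructor
    · rintro ⟨⟨h1, -⟩, h2⟩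
      exact ⟨h1, h2⟩
    · rintro ⟨h1, h2⟩
      exact ⟨⟨h1, by rw [h2]; exact (hmem N).2 hN⟩, h2⟩
  · intro u hu
    rw [(mem_filter.1 hu).2]

lemma layerTerm_eq_zero_of_lt {k n t d : ℕ} (e : ℕ) (ht : 0 < t) (hd : n < d) :
    layerTerm k n t d e = 0 := by
  refine Finset.sum_eq_zero fun N hN => ?_
  have h1 : n < N := lt_of_lt_of_le (hd.trans_le (Nat.le_mul_of_pos_right d ht)) (mem_Ico.1 hN).1
  simp [layerCount, Nat.div_eq_of_lt h1, Nat.div_eq_of_lt (h1.trans (Nat.lt_succ_self N))]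

/-- The density version of `layerTerm`. -/
noncomputable def layerDensity (k t d : ℕ) : ℝ :=
  ∑ N ∈ Ico (d * t) (d * (t + 1)), jump k d N * (1 / (N : ℝ) - 1 / ((N + 1 : ℕ) : ℝ))

lemma sum_Ico_mul_blocks (f : ℕ → ℝ) (d : ℕ) {A B : ℕ} (h : A ≤ B) :
    ∑ t ∈ Ico A B, ∑ N ∈ Ico (d * t) (d * (t + 1)), f N = ∑ N ∈ Ico (d * A) (d * B), f N := by
  induction B, h using Nat.le_induction with
  | base => simp
  | succ B hB ih =>
    rw [Finset.sum_Ico_succ_top hB, ih, Finset.sum_Ico_consecutive _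
      (Nat.mul_le_mul_left d hB) (Nat.mul_le_mul_left d (Nat.le_succ B))]

lemma sum_Ico_sub_succ (f : ℕ → ℝ) {A B : ℕ} (h : A ≤ B) :
    ∑ N ∈ Ico A B, (f N - f (N + 1)) = f A - f B := by
  have := Finset.sum_Ico_sub f h
  rw [← neg_sub (f B), ← this, ← Finset.sum_neg_distrib]
  simp

lemma div_div_le_real (n N e : ℕ) : ((n / N / e : ℕ) : ℝ) ≤ (n : ℝ) / e * (1 / N) := by
  rw [Nat.div_div_eq_div_mul]
  refine Nat.cast_div_le.trans (le_of_eq ?_)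
  push_cast
  rw [div_mul_div_comm, mul_one, mul_comm (N : ℝ)]

lemma lt_div_div_add_one (n : ℕ) {N e : ℕ} (hN : 0 < N) (he : 0 < e) :
    (n : ℝ) / e * (1 / N) < ((n / N / e : ℕ) : ℝ) + 1 := by
  rw [Nat.div_div_eq_div_mul, div_mul_div_comm, mul_one, div_lt_iff₀ (by positivity)]
  have := Nat.lt_mul_div_succ n (Nat.mul_pos hN he)
  rw [mul_comm, mul_comm N e] at this
  rw [mul_comm N e]
  exact_mod_cast this

lemma sum_layerTerm_sub_le_sum (k n : ℕ) (d e : ℕ) {A B : ℕ} (h : A ≤ B) :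
    ∑ t ∈ Ico A B, |layerTerm k n t d e - (n : ℝ) / e * layerDensity k t d| ≤
      ∑ N ∈ Ico (d * A) (d * B),
        |layerCount n e N - (n : ℝ) / e * (1 / (N : ℝ) - 1 / ((N + 1 : ℕ) : ℝ))| := by
  rw [← sum_Ico_mul_blocks _ d h]
  refine Finset.sum_le_sum fun t _ => ?_
  rw [layerTerm, layerDensity, Finset.mul_sum, ← Finset.sum_sub_distrib]
  refine (Finset.abs_sum_le_sum_abs _ _).trans (Finset.sum_le_sum fun N _ => ?_)
  rw [mul_left_comm, ← mul_sub, abs_mul]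
  exact mul_le_of_le_one_left (abs_nonneg _) (abs_jump_le_one k d N)

lemma sum_layerTerm_sub_le_card (k n : ℕ) {d e A : ℕ} (hd : 0 < d) (he : 0 < e) (hA : 0 < A) :
    ∑ t ∈ Ico A (2 * A), |layerTerm k n t d e - (n : ℝ) / e * layerDensity k t d| ≤ d * A := by
  refine (sum_layerTerm_sub_le_sum k n d e (by omega)).trans ?_
  have : ∀ N ∈ Ico (d * A) (d * (2 * A)),
      |layerCount n e N - (n : ℝ) / e * (1 / (N : ℝ) - 1 / ((N + 1 : ℕ) : ℝ))| ≤ 1 := by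
    intro N hN
    have hN0 : 0 < N := lt_of_lt_of_le (Nat.mul_pos hd hA) (mem_Ico.1 hN).1
    have h1 := div_div_le_real n N e
    have h2 := div_div_le_real n (N + 1) e
    have h3 := lt_div_div_add_one n hN0 he
    have h4 := lt_div_div_add_one n (Nat.succ_pos N) he
    rw [layerCount, abs_le, mul_sub]
    constructor <;> simp only [Nat.succ_eq_add_one] at * <;> linarith
  refine (Finset.sum_le_sum this).trans (le_of_eq ?_)
  rw [Finset.sum_const, Nat.card_Ico, nsmul_eq_mul, mul_one,
    show d * (2 * A) - d * A = d * A by rw [← Nat.mul_sub]; congr 1; omega]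
  push_cast
  ring

lemma sum_layerTerm_sub_le_div (k n : ℕ) {d e A : ℕ} (hd : 0 < d) (he : 0 < e) (hA : 0 < A) :
    ∑ t ∈ Ico A (2 * A), |layerTerm k n t d e - (n : ℝ) / e * layerDensity k t d| ≤
      2 * n / (e * d * A) := by
  refine (sum_layerTerm_sub_le_sum k n d e (by omega)).trans ?_
  have : ∀ N ∈ Ico (d * A) (d * (2 * A)),
      |layerCount n e N - (n : ℝ) / e * (1 / (N : ℝ) - 1 / ((N + 1 : ℕ) : ℝ))| ≤
      (((n / N / e : ℕ) : ℝ) - ((n / (N + 1) / e : ℕ) : ℝ)) +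
        (n / e * (1 / (N : ℝ)) - n / e * (1 / ((N + 1 : ℕ) : ℝ))) := by
    intro N hN
    have hN0 : 0 < N := lt_of_lt_of_le (Nat.mul_pos hd hA) (mem_Ico.1 hN).1
    refine (abs_sub _ _).trans (le_of_eq ?_)
    rw [abs_of_nonneg, abs_of_nonneg, layerCount, mul_sub]
    · refine mul_nonneg (by positivity) (sub_nonneg.2 ?_)
      exact one_div_le_one_div_of_le (by positivity) (by push_cast; linarith)
    · rw [layerCount, sub_nonneg]
      exact_mod_cast Nat.div_le_div_right (Nat.div_le_div_left (Nat.le_succ N) hN0)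
  refine (Finset.sum_le_sum this).trans ?_
  have hle : d * A ≤ d * (2 * A) := Nat.mul_le_mul_left d (by omega)
  rw [Finset.sum_add_distrib, sum_Ico_sub_succ (fun N => ((n / N / e : ℕ) : ℝ)) hle,
    sum_Ico_sub_succ (fun N => (n : ℝ) / e * (1 / (N : ℝ))) hle]
  have h1 := div_div_le_real n (d * A) e
  have h2 : (0 : ℝ) ≤ ((n / (d * (2 * A)) / e : ℕ) : ℝ) := Nat.cast_nonneg _
  have h3 : (0 : ℝ) ≤ n / e * (1 / ((d * (2 * A) : ℕ) : ℝ)) := by positivity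
  have h4 : (2 * n / (e * d * A) : ℝ) = 2 * (n / e * (1 / ((d * A : ℕ) : ℝ))) := by
    push_cast
    field_simp
  rw [h4]
  linarith

/-- Interpolation between the two bounds for the rounding errors. -/
lemma sum_layerTerm_sub_le (k : ℕ) {n d e A : ℕ} {σ : ℝ} (hd : 0 < d) (he : 0 < e)
    (hA : 0 < A) (hn : 0 < n) (h0 : 0 ≤ σ) (h1 : σ ≤ 1) :
    ∑ t ∈ Ico A (2 * A), |layerTerm k n t d e - (n : ℝ) / e * layerDensity k t d| ≤
      2 * (n : ℝ) ^ (1 - σ / 2) * (A : ℝ) ^ (σ - 1) * (d : ℝ) ^ (σ - 1) * (e : ℝ) ^ (σ - 1) := by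
  set y := ∑ t ∈ Ico A (2 * A), |layerTerm k n t d e - (n : ℝ) / e * layerDensity k t d|
  have hy0 : 0 ≤ y := Finset.sum_nonneg fun _ _ => abs_nonneg _
  have hy1 : y ≤ d * A := sum_layerTerm_sub_le_card k n hd he hA
  have hy2 : y ≤ 2 * n / (e * d * A) := sum_layerTerm_sub_le_div k n hd he hA
  have hd' : (0 : ℝ) < d := by exact_mod_cast hd
  have he' : (0 : ℝ) < e := by exact_mod_cast he
  have hA' : (0 : ℝ) < A := by exact_mod_cast hA
  have hn' : (0 : ℝ) < n := by exact_mod_cast hn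
  have e1 : (1 : ℝ) ≤ e := by exact_mod_cast he
  calc y = y ^ (σ / 2) * y ^ (1 - σ / 2) := by
        rw [← Real.rpow_add' hy0 (by norm_num)]; simp
    _ ≤ (d * A) ^ (σ / 2) * (2 * n / (e * d * A)) ^ (1 - σ / 2) := by
        gcongr
        linarith
    _ = 2 ^ (1 - σ / 2) * (n : ℝ) ^ (1 - σ / 2) * (A : ℝ) ^ (σ - 1) * (d : ℝ) ^ (σ - 1) *
        (e : ℝ) ^ (σ / 2 - 1) := by
        rw [show σ - 1 = σ / 2 - (1 - σ / 2) by ring, show σ / 2 - 1 = -(1 - σ / 2) by ring]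
        generalize σ / 2 = a
        generalize 1 - a = b
        rw [Real.div_rpow (by positivity) (by positivity), Real.mul_rpow (by positivity) hA'.le,
          Real.mul_rpow (by positivity) hA'.le, Real.mul_rpow (by positivity) hd'.le,
          Real.mul_rpow (by positivity) hn'.le,
          Real.rpow_sub hA', Real.rpow_sub hd', Real.rpow_neg he'.le]
        field_simp
    _ ≤ 2 * (n : ℝ) ^ (1 - σ / 2) * (A : ℝ) ^ (σ - 1) * (d : ℝ) ^ (σ - 1) *
        (e : ℝ) ^ (σ - 1) := by
        gcongr
        · calc (2 : ℝ) ^ (1 - σ / 2) ≤ 2 ^ (1 : ℝ) :=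
              Real.rpow_le_rpow_of_exponent_le (by norm_num) (by linarith)
            _ = 2 := Real.rpow_one 2
        · linarith

/-- `d ^ (σ - 1)` supported on the `B`-smooth numbers. -/
noncomputable def smoothWeight (B : ℕ) (σ : ℝ) (d : ℕ) : ℝ :=
  if d ∈ Nat.smoothNumbers B then (d : ℝ) ^ (σ - 1) else 0

lemma smoothWeight_nonneg (B : ℕ) (σ : ℝ) (d : ℕ) : 0 ≤ smoothWeight B σ d := by
  unfold smoothWeight
  split_ifs
  · positivity
  · exact le_rfl

lemma hasSum_smoothWeight (B : ℕ) {σ : ℝ} (hσ : σ < 1) :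
    HasSum (smoothWeight B σ) (∏ p ∈ B.primesBelow, (1 - (p : ℝ) ^ (σ - 1))⁻¹) := by
  let f : ℕ →* ℝ :=
    { toFun := fun m => (m : ℝ) ^ (σ - 1)
      map_one' := by simp
      map_mul' := fun a b => by
        push_cast
        exact Real.mul_rpow (Nat.cast_nonneg a) (Nat.cast_nonneg b) }
  have h := (EulerProduct.summable_and_hasSum_smoothNumbers_prod_primesBelow_geometric (f := f)
    (fun {p} hp => by
      have h1 : (1 : ℝ) < p := by exact_mod_cast hp.one_lt
      change ‖(p : ℝ) ^ (σ - 1)‖ < 1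
      rw [Real.norm_of_nonneg (by positivity)]
      exact Real.rpow_lt_one_of_one_lt_of_neg h1 (by linarith)) B).2
  have h' := (hasSum_subtype_iff_indicator (f := f) (s := B.smoothNumbers)).1 h
  convert h' using 1
  · ext d
    simp only [smoothWeight, Set.indicator_apply]
    rfl
  · rfl

lemma summable_smoothWeight (B : ℕ) {σ : ℝ} (hσ : σ < 1) : Summable (smoothWeight B σ) :=
  (hasSum_smoothWeight B hσ).summable

lemma inv_one_sub_le_exp {x : ℝ} (h0 : 0 ≤ x) (h1 : x ≤ 3 / 4) : (1 - x)⁻¹ ≤ Real.exp (4 * x) := by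
  rw [inv_le_comm₀ (by linarith) (Real.exp_pos _), ← Real.exp_neg]
  have h2 : 0 ≤ 1 + 4 * x := by linarith
  rw [Real.exp_neg]
  have h3 := Real.add_one_le_exp (4 * x)
  calc (Real.exp (4 * x))⁻¹ ≤ (4 * x + 1)⁻¹ := inv_anti₀ (by linarith) h3
    _ ≤ 1 - x := by
      rw [inv_le_iff_one_le_mul₀ (by linarith)]
      nlinarith

lemma two_rpow_neg_half_le : (2 : ℝ) ^ (-(1 / 2) : ℝ) ≤ 3 / 4 := by
  rw [Real.rpow_neg (by norm_num), ← Real.sqrt_eq_rpow,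
    inv_le_comm₀ (by positivity) (by norm_num)]
  exact Real.le_sqrt_of_sq_le (by norm_num)

lemma tsum_smoothWeight_le (B : ℕ) {σ : ℝ} (h0 : 0 ≤ σ) (h1 : σ ≤ 1 / 2) :
    ∑' d, smoothWeight B σ d ≤
      Real.exp (4 * (B : ℝ) ^ σ * ∑ p ∈ B.primesBelow, (1 : ℝ) / p) := by
  rw [(hasSum_smoothWeight B (by linarith)).tsum_eq, Finset.mul_sum, Real.exp_sum]
  refine Finset.prod_le_prod (fun p hp => ?_) (fun p hp => ?_)
  all_goals
    have hpp := Nat.prime_of_mem_primesBelow hp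
    have h2 : (2 : ℝ) ≤ p := by exact_mod_cast hpp.two_le
    have h3 : (p : ℝ) ^ (σ - 1) ≤ 3 / 4 := by
      calc (p : ℝ) ^ (σ - 1) ≤ 2 ^ (σ - 1) :=
            Real.rpow_le_rpow_of_nonpos (by norm_num) h2 (by linarith)
        _ ≤ 2 ^ (-(1 / 2) : ℝ) :=
            Real.rpow_le_rpow_of_exponent_le (by norm_num) (by linarith)
        _ ≤ 3 / 4 := two_rpow_neg_half_le
  · exact inv_nonneg.2 (by linarith)
  · refine (inv_one_sub_le_exp (by positivity) h3).trans (Real.exp_le_exp.2 ?_)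
    have h4 : (p : ℝ) ≤ B := by exact_mod_cast (Nat.lt_of_mem_primesBelow hp).le
    rw [Real.rpow_sub (by linarith), Real.rpow_one, mul_assoc, mul_one_div]
    gcongr

lemma sum_inv_primes_dyadic_le {j : ℕ} (hj : 0 < j) :
    ∑ p ∈ (Nat.primesBelow (2 ^ (j + 1))).filter (2 ^ j ≤ ·), (1 : ℝ) / p ≤ 4 / j := by
  set Q := (Nat.primesBelow (2 ^ (j + 1))).filter (2 ^ j ≤ ·) with hQ
  have h1 : (2 ^ j) ^ Q.card ≤ 2 ^ (2 ^ (j + 2)) := by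
    calc (2 ^ j) ^ Q.card ≤ ∏ p ∈ Q, p :=
          Finset.pow_card_le_prod _ _ _ fun p hp => (mem_filter.1 hp).2
      _ ≤ primorial (2 ^ (j + 1)) := by
          refine Nat.le_of_dvd (primorial_pos _) (Finset.prod_dvd_prod_of_subset _ _ _ ?_)
          intro p hp
          have hp' := (mem_filter.1 hp).1
          have := Nat.lt_of_mem_primesBelow hp'
          simp only [mem_filter, mem_range]
          exact ⟨by omega, Nat.prime_of_mem_primesBelow hp'⟩
      _ ≤ 4 ^ (2 ^ (j + 1)) := primorial_le_four_pow _
      _ = 2 ^ (2 ^ (j + 2)) := by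
          rw [show 4 = 2 ^ 2 by norm_num, ← pow_mul]
          congr 1
          ring
  rw [← pow_mul] at h1
  have h2 : j * Q.card ≤ 2 ^ (j + 2) := (Nat.pow_le_pow_iff_right (by norm_num)).1 h1
  have h3 : (j : ℝ) * Q.card ≤ 2 ^ j * 4 := by
    have : ((j * Q.card : ℕ) : ℝ) ≤ ((2 ^ (j + 2) : ℕ) : ℝ) := by exact_mod_cast h2
    push_cast at this
    rw [pow_add] at this
    linarith
  have hj' : (0 : ℝ) < j := by exact_mod_cast hj
  calc ∑ p ∈ Q, (1 : ℝ) / p ≤ ∑ _p ∈ Q, (1 : ℝ) / 2 ^ j := by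
        refine Finset.sum_le_sum fun p hp => one_div_le_one_div_of_le (by positivity) ?_
        exact_mod_cast (mem_filter.1 hp).2
    _ = Q.card / 2 ^ j := by rw [Finset.sum_const, nsmul_eq_mul, mul_one_div]
    _ ≤ 4 / j := by
        rw [div_le_div_iff₀ (by positivity) hj']
        linarith

lemma sum_inv_primes_le_harmonic (i : ℕ) :
    ∑ p ∈ Nat.primesBelow (2 ^ (i + 1)), (1 : ℝ) / p ≤ 4 * harmonic i := by
  induction i with
  | zero => simp [Nat.primesBelow, show range 2 = {0, 1} by rfl, Finset.filter_insert,
      Finset.filter_singleton, Nat.not_prime_zero, Nat.not_prime_one]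
  | succ i ih =>
    rw [← Finset.sum_filter_not_add_sum_filter _ (2 ^ (i + 1) ≤ ·), harmonic_succ]
    have h1 := sum_inv_primes_dyadic_le (Nat.succ_pos i)
    have h2 : (Nat.primesBelow (2 ^ (i + 1 + 1))).filter (fun p => ¬ 2 ^ (i + 1) ≤ p) =
        Nat.primesBelow (2 ^ (i + 1)) := by
      ext p
      have : 2 ^ (i + 1) ≤ 2 ^ (i + 1 + 1) := Nat.pow_le_pow_right (by norm_num) (by omega)
      simp only [mem_filter, Nat.mem_primesBelow]
      constructor
      · rintro ⟨⟨-, h⟩, h'⟩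
        exact ⟨by omega, h⟩
      · rintro ⟨h, h'⟩
        exact ⟨⟨by omega, h'⟩, by omega⟩
    rw [h2]
    push_cast at h1 ⊢
    rw [mul_add, ← div_eq_mul_inv]
    exact add_le_add ih h1

lemma sum_inv_primes_le_log (i : ℕ) :
    ∑ p ∈ Nat.primesBelow (2 ^ (i + 1)), (1 : ℝ) / p ≤ 4 * (1 + Real.log i) := by
  refine (sum_inv_primes_le_harmonic i).trans ?_
  gcongr
  exact harmonic_le_one_add_log i

/-- The contribution of `d` to the density of a layer. -/
noncomputable def densityTerm (k t d : ℕ) : ℝ :=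
  if d ∈ Nat.smoothNumbers (t + 1) then
    ∑ e ∈ (primorial t).divisors,
      (ArithmeticFunction.moebius e : ℝ) * (1 / (e : ℝ) * layerDensity k t d)
  else 0

/-- The contribution of `d` to a layer. -/
noncomputable def countTerm (k n t d : ℕ) : ℝ :=
  if d ∈ Nat.smoothNumbers (t + 1) then
    ∑ e ∈ (primorial t).divisors, (ArithmeticFunction.moebius e : ℝ) * layerTerm k n t d e
  else 0

lemma countTerm_eq_zero {k n t d : ℕ} (ht : 0 < t) (hd : d ∉ Icc 1 n) : countTerm k n t d = 0 := by
  unfold countTerm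
  split_ifs with h
  · have := Nat.ne_zero_of_mem_smoothNumbers h
    refine Finset.sum_eq_zero fun e _ => ?_
    rw [layerTerm_eq_zero_of_lt e ht (by rw [mem_Icc] at hd; omega), mul_zero]
  · rfl

lemma jumpLayer_eq_tsum {k : ℕ} (hk : 0 < k) (n : ℕ) {t : ℕ} (ht : 0 < t) :
    jumpLayer k n t = ∑' d, countTerm k n t d := by
  rw [tsum_eq_sum (s := Icc 1 n) fun d hd => countTerm_eq_zero ht hd, jumpLayer_eq hk n ht,
    Finset.sum_filter]
  rfl

lemma summable_countTerm {k n t : ℕ} (ht : 0 < t) : Summable (countTerm k n t) :=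
  summable_of_ne_finset_zero (s := Icc 1 n) fun _ hd => countTerm_eq_zero ht hd

lemma mem_smoothNumbers_of_dvd_primorial {t e : ℕ} (he : e ∣ primorial t) :
    e ∈ Nat.smoothNumbers (t + 1) :=
  Nat.mem_smoothNumbers'.2 fun _ hp hpe =>
    Nat.lt_succ_of_le (hp.dvd_primorial_iff.1 (hpe.trans he))

lemma abs_moebius_le_one_real (e : ℕ) : |(ArithmeticFunction.moebius e : ℝ)| ≤ 1 := by
  exact_mod_cast ArithmeticFunction.abs_moebius_le_one

lemma sum_countTerm_sub_le (k : ℕ) {n A : ℕ} {σ : ℝ} (d : ℕ)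
    (hA : 0 < A) (hn : 0 < n) (h0 : 0 ≤ σ) (h1 : σ < 1) :
    ∑ t ∈ Ico A (2 * A), |countTerm k n t d - n * densityTerm k t d| ≤
      2 * (n : ℝ) ^ (1 - σ / 2) * (A : ℝ) ^ (σ - 1) * (∑' e, smoothWeight (2 * A) σ e) *
        smoothWeight (2 * A) σ d := by
  by_cases hd : d ∈ Nat.smoothNumbers (2 * A)
  · have hd0 : 0 < d := Nat.pos_of_ne_zero (Nat.ne_zero_of_mem_smoothNumbers hd)
    set P := (primorial (2 * A - 1)).divisors with hP
    calc ∑ t ∈ Ico A (2 * A), |countTerm k n t d - n * densityTerm k t d|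
        ≤ ∑ t ∈ Ico A (2 * A), ∑ e ∈ P,
            |layerTerm k n t d e - (n : ℝ) / e * layerDensity k t d| := by
          refine Finset.sum_le_sum fun t ht => ?_
          rw [mem_Ico] at ht
          unfold countTerm densityTerm
          split_ifs
          · rw [Finset.mul_sum, ← Finset.sum_sub_distrib]
            refine (Finset.abs_sum_le_sum_abs _ _).trans ?_
            refine (Finset.sum_le_sum (g := fun e =>
              |layerTerm k n t d e - (n : ℝ) / e * layerDensity k t d|) fun e _ => ?_).trans ?_
            · rw [mul_left_comm, ← mul_sub, abs_mul, ← mul_assoc (n : ℝ), mul_one_div]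
              exact mul_le_of_le_one_left (abs_nonneg _) (abs_moebius_le_one_real e)
            · refine Finset.sum_le_sum_of_subset_of_nonneg ?_ fun _ _ _ => abs_nonneg _
              exact Nat.divisors_subset_of_dvd (primorial_ne_zero _)
                (primorial_dvd_primorial (by omega))
          · simp only [mul_zero, sub_zero, abs_zero]
            exact Finset.sum_nonneg fun _ _ => abs_nonneg _
      _ = ∑ e ∈ P, ∑ t ∈ Ico A (2 * A),
            |layerTerm k n t d e - (n : ℝ) / e * layerDensity k t d| := Finset.sum_comm
      _ ≤ ∑ e ∈ P, 2 * (n : ℝ) ^ (1 - σ / 2) * (A : ℝ) ^ (σ - 1) * (d : ℝ) ^ (σ - 1) *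
            smoothWeight (2 * A) σ e := by
          refine Finset.sum_le_sum fun e he => ?_
          have hed := Nat.dvd_of_mem_divisors he
          have hes := mem_smoothNumbers_of_dvd_primorial hed
          rw [Nat.sub_add_cancel (by omega)] at hes
          rw [smoothWeight, if_pos hes]
          exact sum_layerTerm_sub_le k hd0
            (Nat.pos_of_ne_zero (Nat.ne_zero_of_mem_smoothNumbers hes)) hA hn h0 h1.le
      _ ≤ 2 * (n : ℝ) ^ (1 - σ / 2) * (A : ℝ) ^ (σ - 1) * (d : ℝ) ^ (σ - 1) *
            ∑' e, smoothWeight (2 * A) σ e := by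
          rw [← Finset.mul_sum]
          gcongr
          exact (summable_smoothWeight _ h1).sum_le_tsum _ fun e _ => smoothWeight_nonneg _ _ e
      _ = _ := by
          rw [smoothWeight, if_pos hd]
          ring
  · have hz : ∀ t ∈ Ico A (2 * A), |countTerm k n t d - n * densityTerm k t d| = 0 := by
      intro t ht
      rw [mem_Ico] at ht
      have : d ∉ Nat.smoothNumbers (t + 1) :=
        fun h => hd (Nat.smoothNumbers_mono (by omega) h)
      simp [countTerm, densityTerm, this]
    rw [Finset.sum_eq_zero hz, smoothWeight, if_neg hd, mul_zero]

lemma summable_abs_countTerm_sub (k : ℕ) {n t : ℕ} (ht : 0 < t) (hn : 0 < n) :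
    Summable fun d => |countTerm k n t d - n * densityTerm k t d| := by
  refine Summable.of_nonneg_of_le (fun _ => abs_nonneg _) (fun d => ?_)
    ((summable_smoothWeight (2 * t) (σ := 0) one_pos).mul_left
      (2 * (n : ℝ) ^ (1 - (0 : ℝ) / 2) * (t : ℝ) ^ ((0 : ℝ) - 1) *
        (∑' e, smoothWeight (2 * t) 0 e)))
  refine le_trans ?_ (sum_countTerm_sub_le k d ht hn le_rfl one_pos)
  exact Finset.single_le_sum (f := fun t => |countTerm k n t d - n * densityTerm k t d|)
    (fun _ _ => abs_nonneg _) (mem_Ico.2 ⟨le_rfl, by omega⟩)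

lemma summable_densityTerm (k : ℕ) {t : ℕ} (ht : 0 < t) : Summable (densityTerm k t) := by
  have h1 := (summable_abs_countTerm_sub k ht one_pos).of_abs
  have h2 := (summable_countTerm (k := k) (n := 1) ht).sub h1
  simpa using h2

/-- The limiting density of a layer. -/
noncomputable def limitDensity (k t : ℕ) : ℝ := ∑' d, densityTerm k t d

lemma abs_tsum_le_tsum_abs {f : ℕ → ℝ} (hf : Summable fun d => |f d|) :
    |∑' d, f d| ≤ ∑' d, |f d| :=
  norm_tsum_le_tsum_norm (f := f) hf

lemma sum_jumpLayer_sub_le {k : ℕ} (hk : 0 < k) {n A : ℕ} {σ : ℝ}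
    (hA : 0 < A) (hn : 0 < n) (h0 : 0 ≤ σ) (h1 : σ < 1) :
    ∑ t ∈ Ico A (2 * A), |jumpLayer k n t - n * limitDensity k t| ≤
      2 * (n : ℝ) ^ (1 - σ / 2) * (A : ℝ) ^ (σ - 1) * (∑' e, smoothWeight (2 * A) σ e) ^ 2 := by
  have ht : ∀ t ∈ Ico A (2 * A), 0 < t := fun t h => hA.trans_le (mem_Ico.1 h).1
  have hs : ∀ t ∈ Ico A (2 * A), Summable fun d => |countTerm k n t d - n * densityTerm k t d| :=
    fun t h => summable_abs_countTerm_sub k (ht t h) hn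
  have h2 : ∀ t ∈ Ico A (2 * A), |jumpLayer k n t - n * limitDensity k t| ≤
      ∑' d, |countTerm k n t d - n * densityTerm k t d| := by
    intro t h
    rw [jumpLayer_eq_tsum hk n (ht t h), limitDensity, ← tsum_mul_left,
      ← (summable_countTerm (ht t h)).tsum_sub ((summable_densityTerm k (ht t h)).mul_left _)]
    exact abs_tsum_le_tsum_abs (hs t h)
  refine (Finset.sum_le_sum h2).trans ?_
  rw [← Summable.tsum_finsetSum hs]
  have h3 := fun d => sum_countTerm_sub_le k (σ := σ) d hA hn h0 h1
  have h4 := summable_sum hs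
  generalize 2 * (n : ℝ) ^ (1 - σ / 2) * (A : ℝ) ^ (σ - 1) = c at h3 ⊢
  have h5 := (summable_smoothWeight (2 * A) h1).mul_left (c * ∑' e, smoothWeight (2 * A) σ e)
  refine (h4.tsum_le_tsum h3 h5).trans (le_of_eq ?_)
  rw [tsum_mul_left, sq, mul_assoc]

lemma abs_jumpLayer_le (k n : ℕ) {t : ℕ} (ht : 0 < t) :
    |jumpLayer k n t| ≤ n * (1 / (t : ℝ) - 1 / ((t + 1 : ℕ) : ℝ)) + 1 := by
  have h1 : |jumpLayer k n t| ≤ layerCount n 1 t := by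
    rw [← card_dvd_div_eq n 1 ht, Finset.card_eq_sum_ones]
    push_cast
    refine (Finset.abs_sum_le_sum_abs _ _).trans ?_
    simp only [isUnit_one, IsUnit.dvd, Finset.filter_true]
    exact Finset.sum_le_sum fun s _ => abs_jump_le_one k s n
  refine h1.trans ?_
  have h2 := div_div_le_real n t 1
  have h3 := lt_div_div_add_one n (Nat.succ_pos t) one_pos
  simp only [Nat.cast_one, div_one, Nat.succ_eq_add_one] at h2 h3
  rw [layerCount, mul_sub]
  simp only [Nat.div_one] at *
  linarith

lemma abs_limitDensity_le {k : ℕ} (hk : 0 < k) {t : ℕ} (ht : 0 < t) :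
    |limitDensity k t| ≤ 1 / (t : ℝ) - 1 / ((t + 1 : ℕ) : ℝ) := by
  set c := 2 * (t : ℝ) ^ ((1 / 2 : ℝ) - 1) * (∑' e, smoothWeight (2 * t) (1 / 2) e) ^ 2
  have hlim : Filter.Tendsto (fun n : ℕ => 1 / (t : ℝ) - 1 / ((t + 1 : ℕ) : ℝ) +
      (1 + c) * (n : ℝ) ^ (-(1 / 4) : ℝ)) Filter.atTop
      (nhds (1 / (t : ℝ) - 1 / ((t + 1 : ℕ) : ℝ) + (1 + c) * 0)) :=
    (((tendsto_rpow_neg_atTop (by norm_num)).comp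
      tendsto_natCast_atTop_atTop).const_mul _).const_add _
  rw [mul_zero, add_zero] at hlim
  refine ge_of_tendsto hlim ?_
  filter_upwards [Filter.eventually_ge_atTop 1] with n hn
  have hn' : (1 : ℝ) ≤ n := by exact_mod_cast hn
  have hn0 : (0 : ℝ) < n := by linarith
  have h1 := sum_jumpLayer_sub_le hk (n := n) (σ := 1 / 2) ht hn (by norm_num) (by norm_num)
  have h2 : |jumpLayer k n t - n * limitDensity k t| ≤ c * (n : ℝ) ^ (3 / 4 : ℝ) := by
    refine (Finset.single_le_sum (f := fun t => |jumpLayer k n t - n * limitDensity k t|)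
      (fun _ _ => abs_nonneg _) (mem_Ico.2 ⟨le_rfl, by omega⟩)).trans (h1.trans (le_of_eq ?_))
    rw [show (1 - 1 / 2 / 2 : ℝ) = 3 / 4 by norm_num]
    ring
  have h3 := abs_jumpLayer_le k n ht
  have h4 : |n * limitDensity k t| ≤ |jumpLayer k n t - n * limitDensity k t| +
      |jumpLayer k n t| := by
    have := abs_sub_abs_le_abs_sub (n * limitDensity k t) (jumpLayer k n t)
    rw [abs_sub_comm] at this
    linarith
  rw [abs_mul, abs_of_pos hn0] at h4
  have h5 : (1 : ℝ) ≤ (n : ℝ) ^ (3 / 4 : ℝ) := Real.one_le_rpow hn' (by norm_num)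
  have h6 : (n : ℝ) * (n : ℝ) ^ (-(1 / 4) : ℝ) = (n : ℝ) ^ (3 / 4 : ℝ) := by
    rw [← Real.rpow_one_add' hn0.le (by norm_num)]
    norm_num
  refine le_of_mul_le_mul_left ?_ hn0
  rw [mul_add, mul_left_comm, h6]
  linarith

lemma exists_density {k : ℕ} (hk : 0 < k) :
    ∃ γ : ℝ, ∀ T : ℕ, 0 < T → |∑ t ∈ Ico 1 T, limitDensity k t - γ| ≤ 1 / T := by
  set S : ℕ → ℝ := fun T => ∑ t ∈ Ico 1 T, limitDensity k t with hS
  have hdist : ∀ T T', 0 < T → T ≤ T' → |S T - S T'| ≤ 1 / T := by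
    intro T T' hT h
    rw [abs_sub_comm]
    simp only [hS]
    rw [← Finset.sum_Ico_consecutive _ hT h, add_sub_cancel_left]
    refine (Finset.abs_sum_le_sum_abs _ _).trans ?_
    refine (Finset.sum_le_sum fun t ht =>
      abs_limitDensity_le hk (hT.trans_le (mem_Ico.1 ht).1)).trans ?_
    rw [sum_Ico_sub_succ (fun t : ℕ => 1 / (t : ℝ)) h]
    exact sub_le_self _ (by positivity)
  have hcauchy : CauchySeq fun N => S (N + 1) := by
    refine cauchySeq_of_le_tendsto_0' (fun N : ℕ => 1 / ((N : ℝ) + 1)) (fun N M h => ?_)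
      tendsto_one_div_add_atTop_nhds_zero_nat
    rw [Real.dist_eq]
    exact_mod_cast hdist (N + 1) (M + 1) (Nat.succ_pos N) (by omega)
  obtain ⟨γ, hγ⟩ := cauchySeq_tendsto_of_complete hcauchy
  refine ⟨γ, fun T hT => ?_⟩
  refine le_of_tendsto (hγ.const_sub (S T)).abs ?_
  filter_upwards [Filter.eventually_ge_atTop T] with N hN
  exact hdist T (N + 1) hT (by omega)

lemma abs_fChain_sub_sum_jumpLayer_le (k n : ℕ) {T : ℕ} (hT : 0 < T) :
    |(fChain k n : ℝ) - ∑ t ∈ Ico 1 T, jumpLayer k n t| ≤ n / T := by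
  have h1 : ∑ t ∈ Ico 1 T, jumpLayer k n t =
      ∑ s ∈ (Icc 1 n).filter (fun s => n / s < T), jump k s n := by
    rw [← Finset.sum_fiberwise_of_maps_to (s := (Icc 1 n).filter (fun s => n / s < T))
      (f := fun s => jump k s n) (g := fun s => n / s) (t := Ico 1 T)]
    · refine Finset.sum_congr rfl fun t ht => ?_
      rw [jumpLayer]
      refine Finset.sum_congr ?_ fun _ _ => rfl
      ext s
      simp only [mem_filter]
      rw [mem_Ico] at ht
      constructor
      · rintro ⟨h, h'⟩
        exact ⟨⟨h, by omega⟩, h'⟩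
      · rintro ⟨⟨h, -⟩, h'⟩
        exact ⟨h, h'⟩
    · intro s hs
      simp only [mem_filter, mem_Icc, mem_Ico] at hs ⊢
      exact ⟨Nat.div_pos hs.1.2 hs.1.1, hs.2⟩
  rw [fChain_eq_sum_jump, h1, ← Finset.sum_filter_add_sum_filter_not (Icc 1 n)
    (fun s => n / s < T), add_sub_cancel_left]
  refine (Finset.abs_sum_le_sum_abs _ _).trans ?_
  refine (Finset.sum_le_card_nsmul _ _ 1 fun s _ => abs_jump_le_one k s n).trans ?_
  rw [nsmul_eq_mul, mul_one]
  have h2 : (Icc 1 n).filter (fun s => ¬ n / s < T) ⊆ Icc 1 (n / T) := by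
    intro s hs
    simp only [mem_filter, mem_Icc, not_lt] at hs ⊢
    refine ⟨hs.1.1, ?_⟩
    rw [Nat.le_div_iff_mul_le hT, mul_comm]
    exact (Nat.le_div_iff_mul_le hs.1.1).1 hs.2
  have h3 := Finset.card_le_card h2
  rw [Nat.card_Icc, Nat.add_sub_cancel] at h3
  calc _ ≤ ((n / T : ℕ) : ℝ) := by exact_mod_cast h3
    _ ≤ n / T := Nat.cast_div_le

lemma sum_Ico_one_two_pow (f : ℕ → ℝ) (J : ℕ) :
    ∑ t ∈ Ico 1 (2 ^ J), f t = ∑ j ∈ range J, ∑ t ∈ Ico (2 ^ j) (2 * 2 ^ j), f t := by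
  induction J with
  | zero => simp
  | succ J ih =>
    rw [Finset.sum_range_succ, ← ih, pow_succ', Finset.sum_Ico_consecutive _ Nat.one_le_two_pow
      (by omega)]

/-- The explicit bound with a free exponent for each dyadic range. -/
lemma abs_fChain_sub_le {k : ℕ} (hk : 0 < k) {γ : ℝ}
    (hγ : ∀ T : ℕ, 0 < T → |∑ t ∈ Ico 1 T, limitDensity k t - γ| ≤ 1 / T)
    {n : ℕ} (hn : 0 < n) (J : ℕ) (b : ℝ)
    (hb : ∀ j < J, ∃ σ : ℝ, 0 ≤ σ ∧ σ ≤ 1 / 2 ∧ (n : ℝ) ^ (-σ / 2) * ((2 : ℝ) ^ j) ^ (σ - 1) *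
      Real.exp (32 * ((2 : ℝ) ^ (j + 1)) ^ σ * (1 + Real.log j)) ≤ b) :
    |(fChain k n : ℝ) - γ * n| ≤ 2 * n / 2 ^ J + J * (2 * n * b) := by
  have hn' : (0 : ℝ) < n := by exact_mod_cast hn
  have hT : 0 < 2 ^ J := by positivity
  have h1 := abs_fChain_sub_sum_jumpLayer_le k n hT
  have h2 := hγ (2 ^ J) hT
  have h3 : |∑ t ∈ Ico 1 (2 ^ J), jumpLayer k n t - n * ∑ t ∈ Ico 1 (2 ^ J), limitDensity k t| ≤
      J * (2 * n * b) := by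
    rw [Finset.mul_sum, ← Finset.sum_sub_distrib]
    refine (Finset.abs_sum_le_sum_abs _ _).trans ?_
    rw [sum_Ico_one_two_pow]
    refine (Finset.sum_le_card_nsmul _ _ (2 * n * b) fun j hj => ?_).trans
      (le_of_eq (by rw [card_range, nsmul_eq_mul]))
    obtain ⟨σ, h0, h1, hσ⟩ := hb j (mem_range.1 hj)
    refine (sum_jumpLayer_sub_le hk (by positivity) hn h0 (by linarith)).trans ?_
    have hZ := tsum_smoothWeight_le (2 * 2 ^ j) h0 h1
    have hZ0 : 0 ≤ ∑' e, smoothWeight (2 * 2 ^ j) σ e :=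
      tsum_nonneg fun e => smoothWeight_nonneg _ _ e
    have hM := sum_inv_primes_le_log j
    have hZ2 : (∑' e, smoothWeight (2 * 2 ^ j) σ e) ^ 2 ≤
        Real.exp (32 * ((2 : ℝ) ^ (j + 1)) ^ σ * (1 + Real.log j)) := by
      refine (pow_le_pow_left₀ hZ0 hZ 2).trans ?_
      rw [← Real.exp_nat_mul, Real.exp_le_exp, ← pow_succ']
      push_cast
      calc 2 * (4 * ((2 : ℝ) ^ (j + 1)) ^ σ * ∑ p ∈ Nat.primesBelow (2 ^ (j + 1)), 1 / (p : ℝ))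
          ≤ 2 * (4 * ((2 : ℝ) ^ (j + 1)) ^ σ * (4 * (1 + Real.log j))) := by gcongr
        _ = _ := by ring
    have hpow : (n : ℝ) ^ (1 - σ / 2) = n * (n : ℝ) ^ (-σ / 2) := by
      rw [neg_div, sub_eq_add_neg, Real.rpow_add hn', Real.rpow_one]
    rw [hpow]
    push_cast
    calc 2 * (n * (n : ℝ) ^ (-σ / 2)) * ((2 : ℝ) ^ j) ^ (σ - 1) *
          (∑' e, smoothWeight (2 * 2 ^ j) σ e) ^ 2
        ≤ 2 * (n * (n : ℝ) ^ (-σ / 2)) * ((2 : ℝ) ^ j) ^ (σ - 1) *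
          Real.exp (32 * ((2 : ℝ) ^ (j + 1)) ^ σ * (1 + Real.log j)) := by gcongr
      _ = 2 * n * ((n : ℝ) ^ (-σ / 2) * ((2 : ℝ) ^ j) ^ (σ - 1) *
          Real.exp (32 * ((2 : ℝ) ^ (j + 1)) ^ σ * (1 + Real.log j))) := by ring
      _ ≤ 2 * n * b := by gcongr
  have h4 : |n * ∑ t ∈ Ico 1 (2 ^ J), limitDensity k t - γ * n| ≤ n / 2 ^ J := by
    rw [mul_comm γ, ← mul_sub, abs_mul, abs_of_pos hn']
    push_cast at h2
    calc _ ≤ n * (1 / (2 : ℝ) ^ J) := by gcongr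
      _ = _ := by ring
  push_cast at h1
  have h5 := abs_sub_le (fChain k n : ℝ) (∑ t ∈ Ico 1 (2 ^ J), jumpLayer k n t) (γ * n)
  have h6 := abs_sub_le (∑ t ∈ Ico 1 (2 ^ J), jumpLayer k n t)
    (n * ∑ t ∈ Ico 1 (2 ^ J), limitDensity k t) (γ * n)
  have h7 : (2 * n / 2 ^ J : ℝ) = n / 2 ^ J + n / 2 ^ J := by ring
  linarith

/-- The choice of the Rankin exponent. -/
lemma exists_rankin_exponent {L R δ A : ℝ} (hL : 1 ≤ Real.log L) (hR : R ^ 2 = L * Real.log L)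
    (hR0 : 0 ≤ R) (hRL : R ≤ L / 4) (hδ : 0 < δ) (hδ' : δ ≤ 1 / 4) (hA : 1 ≤ A) :
    ∃ σ : ℝ, 0 ≤ σ ∧ σ ≤ 1 / 2 ∧ (2 * A) ^ σ ≤ L ^ (1 / 2 - δ) ∧
      Real.exp L ^ (-σ / 2) * A ^ (σ - 1) ≤ 2 * L * Real.exp (-(1 - 2 * δ) * R) := by
  have hL1 : 1 ≤ L := by
    by_contra h
    rcases le_or_gt 0 L with h0 | h0
    · have := Real.log_nonpos h0 (not_le.1 h).le
      linarith
    · linarith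
  set τ := Real.log (2 * A) with hτ
  have hτ0 : 0 < τ := Real.log_pos (by linarith)
  have hA2 : 2 * A = Real.exp τ := (Real.exp_log (by linarith)).symm
  have hLe : L = Real.exp (Real.log L) := (Real.exp_log (by linarith)).symm
  have hLr : ∀ x, L ^ x = Real.exp (Real.log L * x) := Real.rpow_def_of_pos (by linarith)
  rcases le_or_gt ((1 - 2 * δ) * Real.log L) τ with hc | hc
  · set σ := (1 / 2 - δ) * Real.log L / τ with hσ
    have hστ : σ * τ = (1 / 2 - δ) * Real.log L := div_mul_cancel₀ _ hτ0.ne'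
    have hσ0 : 0 ≤ σ := div_nonneg (mul_nonneg (by linarith) (by linarith)) hτ0.le
    have hσ1 : σ ≤ 1 / 2 := by
      rw [hσ, div_le_iff₀ hτ0]
      linarith
    have hBσ : (2 * A) ^ σ = L ^ (1 / 2 - δ) := by
      rw [hA2, ← Real.exp_mul, hLr, mul_comm τ, hστ, mul_comm]
    refine ⟨σ, hσ0, hσ1, hBσ.le, ?_⟩
    have hAσ : A ^ (σ - 1) ≤ 2 * (L * Real.exp (-τ)) := by
      calc A ^ (σ - 1) = A ^ σ / A := by rw [Real.rpow_sub (by linarith), Real.rpow_one]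
        _ ≤ (2 * A) ^ σ / A := by
            gcongr
            linarith
        _ ≤ L / A := by
            rw [hBσ]
            gcongr
            exact Real.rpow_le_self_of_one_le hL1 (by linarith)
        _ = 2 * (L * Real.exp (-τ)) := by
            rw [Real.exp_neg, ← hA2]
            field_simp
    calc Real.exp L ^ (-σ / 2) * A ^ (σ - 1)
        ≤ Real.exp L ^ (-σ / 2) * (2 * (L * Real.exp (-τ))) := by gcongr
      _ = 2 * L * Real.exp (-(σ * L / 2 + τ)) := by
          rw [← Real.exp_mul, neg_add, Real.exp_add]
          ring_nf
      _ ≤ 2 * L * Real.exp (-(1 - 2 * δ) * R) := by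
          gcongr
          rw [neg_mul]
          refine neg_le_neg ?_
          refine le_of_mul_le_mul_right ?_ hτ0
          have h1 : (σ * L / 2 + τ) * τ = (1 / 2 - δ) * R ^ 2 / 2 + τ ^ 2 := by
            rw [hR]
            linear_combination (L / 2) * hστ
          rw [h1]
          nlinarith [sq_nonneg (τ - (1 - 2 * δ) * R / 2),
            mul_nonneg (mul_nonneg hδ.le (by linarith : 0 ≤ 1 - 2 * δ)) (sq_nonneg R)]
  · refine ⟨1 / 2, by norm_num, le_rfl, ?_, ?_⟩
    · rw [hA2, ← Real.exp_mul, hLr, Real.exp_le_exp]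
      linarith
    · calc Real.exp L ^ (-(1 / 2) / 2 : ℝ) * A ^ ((1 / 2 : ℝ) - 1)
          ≤ Real.exp L ^ (-(1 / 2) / 2 : ℝ) * 1 := by
            gcongr
            exact Real.rpow_le_one_of_one_le_of_nonpos hA (by norm_num)
        _ = Real.exp (-(L / 4)) := by
            rw [← Real.exp_mul]
            ring_nf
        _ ≤ Real.exp (-(1 - 2 * δ) * R) := by
            rw [Real.exp_le_exp]
            nlinarith
        _ ≤ 2 * L * Real.exp (-(1 - 2 * δ) * R) :=
            le_mul_of_one_le_left (Real.exp_pos _).le (by linarith)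

lemma eventually_large_log {δ : ℝ} (hδ : 0 < δ) (hδ' : δ ≤ 1 / 4) :
    ∀ᶠ L : ℝ in Filter.atTop, 16 ≤ L ∧ 1 ≤ Real.log L ∧ Real.log L ≤ L / 256 ∧
      32 * L ^ (1 / 2 - δ) * (1 + Real.log L) + 2 * Real.log L + 2 ≤
        δ * √(L * Real.log L) := by
  have h1 := isLittleO_log_rpow_atTop hδ
  have h2 := Real.isLittleO_log_id_atTop
  filter_upwards [h1.def (show 0 < δ / 70 by positivity),
    h2.def (show (0 : ℝ) < 1 / 256 by norm_num), Filter.eventually_ge_atTop 16,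
    Real.tendsto_log_atTop.eventually_ge_atTop 1] with L ha hb hc hd
  rw [Real.norm_of_nonneg (by linarith), Real.norm_of_nonneg (by positivity)] at ha
  rw [Real.norm_of_nonneg (by linarith), id, Real.norm_of_nonneg (by linarith)] at hb
  refine ⟨hc, hd, by linarith, ?_⟩
  have h3 : (1 : ℝ) ≤ L ^ (1 / 2 - δ) := Real.one_le_rpow (by linarith) (by linarith)
  have h4 : L ^ (1 / 2 - δ) * L ^ δ = √L := by
    rw [← Real.rpow_add (by linarith), Real.sqrt_eq_rpow]
    ring_nf
  have h5 : √L ≤ √(L * Real.log L) := Real.sqrt_le_sqrt (le_mul_of_one_le_right (by linarith) hd)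
  calc 32 * L ^ (1 / 2 - δ) * (1 + Real.log L) + 2 * Real.log L + 2
      ≤ 70 * (L ^ (1 / 2 - δ) * Real.log L) := by nlinarith
    _ ≤ 70 * (L ^ (1 / 2 - δ) * (δ / 70 * L ^ δ)) := by gcongr
    _ = δ * √L := by rw [← h4]; ring
    _ ≤ δ * √(L * Real.log L) := by gcongr

lemma eventually_abs_fChain_sub_le {k : ℕ} (hk : 0 < k) {γ : ℝ}
    (hγ : ∀ T : ℕ, 0 < T → |∑ t ∈ Ico 1 T, limitDensity k t - γ| ≤ 1 / T)
    {ε : ℝ} (hε : 0 < ε) :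
    ∀ᶠ n : ℕ in Filter.atTop, |(fChain k n : ℝ) - γ * n| ≤
      3 * (n * Real.exp (-(1 - ε) * √(Real.log n * Real.log (Real.log n)))) := by
  set δ := min (ε / 3) (1 / 4) with hδ_def
  have hδ : 0 < δ := by positivity
  have hδ4 : δ ≤ 1 / 4 := min_le_right _ _
  have hδε : 3 * δ ≤ ε := by linarith [min_le_left (ε / 3) (1 / 4)]
  filter_upwards [(Real.tendsto_log_atTop.comp tendsto_natCast_atTop_atTop).eventually
    (eventually_large_log hδ hδ4), Filter.eventually_gt_atTop 0] with n hn hn0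
  have hn' : (0 : ℝ) < n := by exact_mod_cast hn0
  simp only [Function.comp_apply] at hn
  set L := Real.log n with hL_def
  have hLn : Real.exp L = n := Real.exp_log hn'
  obtain ⟨hL16, hL1, hL256, hmain⟩ := hn
  set R := √(L * Real.log L) with hR_def
  have hR0 : 0 ≤ R := Real.sqrt_nonneg _
  have hR2 : R ^ 2 = L * Real.log L := Real.sq_sqrt (mul_nonneg (by linarith) (by linarith))
  have hRL : R ≤ L / 16 := Real.sqrt_le_iff.2 ⟨by linarith, by nlinarith⟩
  set J := ⌈R / Real.log 2⌉₊ with hJ_def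
  have hlog2 : (1 / 2 : ℝ) < Real.log 2 := by linarith [Real.log_two_gt_d9]
  have hJ1 : R ≤ J * Real.log 2 := (div_le_iff₀ (by linarith)).1 (Nat.le_ceil _)
  have hJ2 : (J : ℝ) ≤ L := by
    have h1 : (J : ℝ) < R / Real.log 2 + 1 := Nat.ceil_lt_add_one (by positivity)
    have h2 : R / Real.log 2 ≤ 2 * R := by
      rw [div_le_iff₀ (by linarith)]
      nlinarith
    linarith
  have h2J : Real.exp R ≤ 2 ^ J := by
    rw [← Real.rpow_natCast, Real.rpow_def_of_pos (by norm_num), Real.exp_le_exp, mul_comm]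
    exact hJ1
  set E := Real.exp (32 * L ^ (1 / 2 - δ) * (1 + Real.log L)) with hE
  have hb : ∀ j < J, ∃ σ : ℝ, 0 ≤ σ ∧ σ ≤ 1 / 2 ∧
      (n : ℝ) ^ (-σ / 2) * ((2 : ℝ) ^ j) ^ (σ - 1) *
      Real.exp (32 * ((2 : ℝ) ^ (j + 1)) ^ σ * (1 + Real.log j)) ≤
        2 * L * Real.exp (-(1 - 2 * δ) * R) * E := by
    intro j hj
    obtain ⟨σ, h0, h1, h2, h3⟩ := exists_rankin_exponent (A := 2 ^ j) hL1 hR2 hR0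
      (by linarith) hδ hδ4 (one_le_pow₀ (by norm_num))
    refine ⟨σ, h0, h1, ?_⟩
    rw [← hLn, pow_succ']
    have hj0 : 0 ≤ Real.log j := Real.log_natCast_nonneg j
    have hjL : Real.log j ≤ Real.log L := by
      rcases Nat.eq_zero_or_pos j with rfl | hj'
      · simp only [Nat.cast_zero, Real.log_zero]
        linarith
      · refine Real.log_le_log (by exact_mod_cast hj') (le_trans ?_ hJ2)
        exact_mod_cast hj.le
    gcongr
    rw [hE]
    gcongr
  refine (abs_fChain_sub_le hk hγ hn0 J _ hb).trans ?_
  have h1 : Real.exp (-R) ≤ Real.exp (-(1 - ε) * R) := by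
    rw [Real.exp_le_exp]
    nlinarith
  have h2 : 2 * n / 2 ^ J ≤ 2 * (n * Real.exp (-(1 - ε) * R)) := by
    calc (2 * n / 2 ^ J : ℝ) ≤ 2 * n / Real.exp R := by gcongr
      _ = 2 * (n * Real.exp (-R)) := by rw [Real.exp_neg]; ring
      _ ≤ _ := by gcongr
  have hexp4 : (4 : ℝ) ≤ Real.exp 2 := by
    have := Real.add_one_le_exp (1 : ℝ)
    rw [show (2 : ℝ) = 1 + 1 by norm_num, Real.exp_add]
    nlinarith
  have h3 : J * (2 * n * (2 * L * Real.exp (-(1 - 2 * δ) * R) * E)) ≤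
      n * Real.exp (-(1 - ε) * R) := by
    calc J * (2 * n * (2 * L * Real.exp (-(1 - 2 * δ) * R) * E))
        ≤ L * (2 * n * (2 * L * Real.exp (-(1 - 2 * δ) * R) * E)) := by gcongr
      _ = n * (4 * (L * L) * E * Real.exp (-(1 - 2 * δ) * R)) := by ring
      _ ≤ n * (Real.exp 2 * (Real.exp (Real.log L) * Real.exp (Real.log L)) * E *
            Real.exp (-(1 - 2 * δ) * R)) := by
          rw [Real.exp_log (by linarith)]
          gcongr
      _ = n * Real.exp (32 * L ^ (1 / 2 - δ) * (1 + Real.log L) + 2 * Real.log L + 2 +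
            -(1 - 2 * δ) * R) := by
          rw [hE, ← Real.exp_add, ← Real.exp_add, ← Real.exp_add, ← Real.exp_add]
          ring_nf
      _ ≤ n * Real.exp (-(1 - ε) * R) := by
          gcongr
          nlinarith
  linarith

/-- An eventual bound by positive numbers becomes a bound everywhere, with another constant. -/
lemma exists_const_of_eventually_le {f g : ℕ → ℝ} {c : ℝ} (hc : 0 ≤ c)
    (h : ∀ᶠ n in Filter.atTop, f n ≤ c * g n) :
    ∃ K, ∀ n, 0 < g n → f n ≤ K * g n := by
  obtain ⟨m, hm⟩ := Filter.eventually_atTop.1 h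
  have hnn : 0 ≤ ∑ i ∈ range m, |f i / g i| := Finset.sum_nonneg fun _ _ => abs_nonneg _
  refine ⟨c + ∑ i ∈ range m, |f i / g i|, fun n hn => ?_⟩
  rcases le_or_gt m n with hmn | hmn
  · exact (hm n hmn).trans (mul_le_mul_of_nonneg_right (by linarith) hn.le)
  · rw [← div_le_iff₀ hn]
    have := Finset.single_le_sum (f := fun i => |f i / g i|) (fun _ _ => abs_nonneg _)
      (mem_range.2 hmn)
    have := le_abs_self (f n / g n)
    linarith

/-- For every `k ≥ 2` there is a real constant `γ_k` with
`f_k(n) = γ_k·n + O_ε(n · exp(−(1−ε)√(log n · log log n)))`. -/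
theorem kChain_density (k : ℕ) (hk : 2 ≤ k) :
    ∃ γ : ℝ, ∀ ε : ℝ, 0 < ε → ∃ K : ℝ, ∀ n : ℕ, 3 ≤ n →
      |(fChain k n : ℝ) - γ * n| ≤
        K * n * Real.exp (-(1 - ε) * Real.sqrt (Real.log n * Real.log (Real.log n))) := by
  obtain ⟨γ, hγ⟩ := exists_density (k := k) (by omega)
  refine ⟨γ, fun ε hε => ?_⟩
  obtain ⟨K, hK⟩ := exists_const_of_eventually_le (by norm_num)
    (eventually_abs_fChain_sub_le (by omega) hγ hε)
  refine ⟨K, fun n hn => ?_⟩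
  rw [mul_assoc]
  refine hK n (mul_pos ?_ (Real.exp_pos _))
  exact_mod_cast (by omega : 0 < n)
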